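/- For each n, let V(n) be the supremum, over all rank-adapted stopping rules τ, of the probability that x_τ is the best, where: a rank-adapted stopping rule is a measurable function τ : [0,1]^n → {1, …, n} such that for each t, the event {x : τ(x) = t} depends only on the relative order of x_1, …, x_t (i.e., whether τ(x) = t is unchanged when x is replaced by any x' with pairwise distinct coordinates satisfying x_i < x_j ⟺ x'_i < x'_j for all i, j ≤ t), and 'x_τ is the best' means |x_{τ(x)} − 1/2| ≤ |x_i − 1/2| for all 1 ≤ i ≤ n. Then √n · V(n) → √(2/π) as n → ∞; equivalently, V(n) is asymptotically equivalent to (1/√n)·√(2/π). -/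

import Mathlib

open MeasureTheory Filter

/-- The uniform probability measure on the cube `[0,1]^n`. -/
noncomputable def unifCube (n : ℕ) : Measure (Fin n → ℝ) :=
  Measure.pi fun _ => volume.restrict (Set.Icc 0 1)

/-- A rank-adapted stopping rule on `[0,1]^n`: a measurable map `τ` to indices such that for
each `t`, whether `τ x = t` depends only on the relative order of the first coordinates
`x_0, …, x_t` (for points with pairwise distinct coordinates). -/
def RankAdapted (n : ℕ) (τ : (Fin n → ℝ) → Fin n) : Prop :=
  Measurable τ ∧
    ∀ t : Fin n, ∀ x x' : Fin n → ℝ, Function.Injective x → Function.Injective x' →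
      (∀ i j : Fin n, i ≤ t → j ≤ t → (x i < x j ↔ x' i < x' j)) →
      (τ x = t ↔ τ x' = t)

/-- `V n` is the optimal success probability: the supremum, over all rank-adapted stopping
rules `τ`, of the probability that the value `x_τ` stopped on is closest to `1/2` among the
`n` i.i.d. uniform values on `[0,1]`. -/
noncomputable def V (n : ℕ) : ℝ :=
  sSup {p : ℝ | ∃ τ : (Fin n → ℝ) → Fin n, RankAdapted n τ ∧
    p = (unifCube n {x | ∀ i, |x (τ x) - 1/2| ≤ |x i - 1/2|}).toReal}

instance isProbabilityMeasure_unifCube (n : ℕ) : IsProbabilityMeasure (unifCube n) := by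
  have : IsProbabilityMeasure (volume.restrict (Set.Icc (0 : ℝ) 1)) := ⟨by simp⟩
  unfold unifCube
  infer_instance

/-- Permuting the coordinates preserves the uniform measure on the cube. -/
theorem measurePreserving_comp_perm {n : ℕ} (σ : Equiv.Perm (Fin n)) :
    MeasurePreserving (fun (x : Fin n → ℝ) => x ∘ σ) (unifCube n) (unifCube n) := by
  have h := measurePreserving_piCongrLeft
    (fun _ : Fin n => volume.restrict (Set.Icc (0 : ℝ) 1)) σ.symm
  have e : (fun (x : Fin n → ℝ) => x ∘ σ) =
      MeasurableEquiv.piCongrLeft (fun _ : Fin n => ℝ) σ.symm := by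
    funext x i
    have := MeasurableEquiv.piCongrLeft_apply_apply (β := fun _ : Fin n => ℝ) σ.symm x (σ i)
    simpa using this.symm
  rw [e]
  exact h

/-- Reflecting the coordinates in `S` about `1/2`. -/
noncomputable def reflectOn {n : ℕ} (S : Finset (Fin n)) (x : Fin n → ℝ) : Fin n → ℝ :=
  fun i => if i ∈ S then 1 - x i else x i

theorem measurePreserving_reflectOn {n : ℕ} (S : Finset (Fin n)) :
    MeasurePreserving (reflectOn S) (unifCube n) (unifCube n) := by
  have key : ∀ i : Fin n, MeasurePreserving (fun y : ℝ => if i ∈ S then 1 - y else y)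
      (volume.restrict (Set.Icc (0 : ℝ) 1)) (volume.restrict (Set.Icc (0 : ℝ) 1)) := by
    intro i
    by_cases hi : i ∈ S
    · simp only [hi, if_true]
      have h := (Measure.measurePreserving_sub_left (volume : Measure ℝ) 1).restrict_preimage
        (measurableSet_Icc (a := (0 : ℝ)) (b := 1))
      have e : (fun y : ℝ => 1 - y) ⁻¹' Set.Icc 0 1 = Set.Icc 0 1 := by
        ext y
        simp only [Set.mem_preimage, Set.mem_Icc]
        constructor <;> rintro ⟨h1, h2⟩ <;> constructor <;> linarith
      rwa [e] at h
    · simp only [hi, if_false]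
      exact MeasurePreserving.id _
  exact measurePreserving_pi _ _ key

theorem abs_reflectOn_sub_half {n : ℕ} (S : Finset (Fin n)) (x : Fin n → ℝ) (i : Fin n) :
    |reflectOn S x i - 1 / 2| = |x i - 1 / 2| := by
  unfold reflectOn
  split_ifs
  · rw [← abs_neg]
    congr 1
    ring
  · rfl

theorem ae_apply_ne_apply {n : ℕ} {i j : Fin n} (hij : i ≠ j) :
    ∀ᵐ x ∂unifCube n, x i ≠ x j := by
  have hac : unifCube n ≪ (volume : Measure (Fin n → ℝ)) := by
    unfold unifCube
    rw [← Measure.restrict_pi_pi]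
    exact Measure.restrict_le_self.absolutelyContinuous
  apply hac.ae_le
  let L : (Fin n → ℝ) →ₗ[ℝ] ℝ :=
    LinearMap.proj (R := ℝ) (φ := fun _ : Fin n => ℝ) i - LinearMap.proj j
  have hL : LinearMap.ker L ≠ ⊤ := by
    intro h
    have h1 : (Pi.single i 1 : Fin n → ℝ) ∈ LinearMap.ker L := by rw [h]; trivial
    simp [L, LinearMap.mem_ker, hij.symm] at h1
  have h0 := Measure.addHaar_submodule (volume : Measure (Fin n → ℝ)) _ hL
  change ∀ᵐ x ∂(volume : Measure (Fin n → ℝ)), x i ≠ x j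
  rw [ae_iff]
  refine measure_mono_null ?_ h0
  intro x hx
  simp only [ne_eq, not_not, Set.mem_ofPred_eq] at hx
  simp [L, LinearMap.mem_ker, hx]

theorem ae_injective_abs_sub_half (n : ℕ) :
    ∀ᵐ x ∂unifCube n, Function.Injective fun i : Fin n => |x i - 1 / 2| := by
  have key : ∀ i j : Fin n, ∀ᵐ x ∂unifCube n, i ≠ j → |x i - 1 / 2| ≠ |x j - 1 / 2| := by
    intro i j
    by_cases hij : i = j
    · simp [hij]
    have h1 := ae_apply_ne_apply hij
    have h2 := (measurePreserving_reflectOn {j}).quasiMeasurePreserving.ae h1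
    filter_upwards [h1, h2] with x hx hx' _ h
    simp only [reflectOn, Finset.mem_singleton, hij, if_false, if_true] at hx'
    rcases abs_eq_abs.1 h with h | h
    · exact hx (by linarith)
    · exact hx' (by linarith)
  have := ae_all_iff.2 fun i => ae_all_iff.2 (key i)
  filter_upwards [this] with x hx i j h
  by_contra hij
  exact hx i j hij h

/-- The coordinate `x i` is strictly closer to `1/2` than all the others. -/
def StrictBest {n : ℕ} (i : Fin n) (x : Fin n → ℝ) : Prop :=
  ∀ j, j ≠ i → |x i - 1 / 2| < |x j - 1 / 2|

theorem StrictBest.unique {n : ℕ} {i j : Fin n} {x : Fin n → ℝ}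
    (hi : StrictBest i x) (hj : StrictBest j x) : i = j := by
  by_contra h
  exact lt_asymm (hi j (Ne.symm h)) (hj i h)

theorem strictBest_comp_perm_symm {n : ℕ} (σ : Equiv.Perm (Fin n)) (i : Fin n) (x : Fin n → ℝ) :
    StrictBest (σ i) (x ∘ σ.symm) ↔ StrictBest i x := by
  constructor
  · intro h j hj
    simpa using h (σ j) (by simpa using hj)
  · intro h j hj
    simpa using h (σ.symm j) (by rwa [ne_eq, Equiv.symm_apply_eq])

theorem measurableSet_strictBest {n : ℕ} (i : Fin n) :
    MeasurableSet {x : Fin n → ℝ | StrictBest i x} := by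
  unfold StrictBest
  simp only [Set.ofPred_forall]
  exact .iInter fun j => .iInter fun _ => measurableSet_lt (by fun_prop) (by fun_prop)

/-- Increasing points whose coordinate of index `k` is the closest to `1/2`. -/
def sortedBest (n : ℕ) (k : Fin n) : Set (Fin n → ℝ) :=
  {x | StrictMono x ∧ StrictBest k x}

theorem measurableSet_sortedBest (n : ℕ) (k : Fin n) : MeasurableSet (sortedBest n k) := by
  refine MeasurableSet.inter ?_ (measurableSet_strictBest k)
  have : {x : Fin n → ℝ | StrictMono x} = {x | ∀ i j, i < j → x i < x j} := by
    ext x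
    exact ⟨fun h i j hij => h hij, fun h i j hij => h i j hij⟩
  change MeasurableSet {x : Fin n → ℝ | StrictMono x}
  rw [this]
  simp only [Set.ofPred_forall]
  exact .iInter fun i => .iInter fun j => .iInter fun _ =>
    measurableSet_lt (by fun_prop) (by fun_prop)

theorem exists_perm_strictMono_comp {n : ℕ} {x : Fin n → ℝ} (hx : Function.Injective x) :
    ∃ σ : Equiv.Perm (Fin n), StrictMono (x ∘ σ.symm) :=
  ⟨(Tuple.sort x).symm,
    (Tuple.monotone_sort x).strictMono_of_injective (hx.comp (Equiv.injective _))⟩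

theorem injective_of_strictMono_comp {n : ℕ} {x : Fin n → ℝ} {σ : Equiv.Perm (Fin n)}
    (h : StrictMono (x ∘ σ.symm)) : Function.Injective x := by
  simpa using h.injective

theorem perm_eq_of_strictMono_comp {n : ℕ} {x : Fin n → ℝ} {σ ρ : Equiv.Perm (Fin n)}
    (h : StrictMono (x ∘ σ.symm)) (h' : StrictMono (x ∘ ρ.symm)) : σ = ρ := by
  have e := Tuple.unique_monotone h.monotone h'.monotone
  have : σ.symm = ρ.symm := by
    ext1 i
    exact injective_of_strictMono_comp h (congrFun e i)
  simpa using congrArg Equiv.symm this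

theorem lt_iff_perm_lt {n : ℕ} {x : Fin n → ℝ} {σ : Equiv.Perm (Fin n)}
    (h : StrictMono (x ∘ σ.symm)) (i j : Fin n) : x i < x j ↔ σ i < σ j := by
  simpa using h.lt_iff_lt (a := σ i) (b := σ j)

theorem card_perm_lt {n : ℕ} (σ : Equiv.Perm (Fin n)) (i : Fin n) :
    (Finset.univ.filter fun j => σ j < σ i).card = σ i := by
  have : (Finset.univ.filter fun j => σ j < σ i) = (Finset.Iio (σ i)).map σ.symm.toEmbedding := by
    ext j
    simp [Finset.mem_map_equiv]
  rw [this, Finset.card_map, Fin.card_Iio]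

theorem measure_iUnion_sortedBest {n : ℕ} (g : Equiv.Perm (Fin n) → Fin n) :
    unifCube n (⋃ σ : Equiv.Perm (Fin n), {x | x ∘ σ.symm ∈ sortedBest n (g σ)}) =
      ∑ σ, unifCube n (sortedBest n (g σ)) := by
  rw [measure_iUnion, tsum_fintype]
  · exact Finset.sum_congr rfl fun σ _ =>
      (measurePreserving_comp_perm σ.symm).measure_preimage
        (measurableSet_sortedBest n _).nullMeasurableSet
  · intro σ ρ hne
    rw [Function.onFun, Set.disjoint_left]
    intro x hx hx'
    exact hne (perm_eq_of_strictMono_comp hx.1 hx'.1)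
  · exact fun σ => (measurePreserving_comp_perm σ.symm).measurable (measurableSet_sortedBest n _)

/-- Coordinate `i` is closest to `1/2` and the smaller coordinates are exactly those in `S`. -/
def bestBelow {n : ℕ} (i : Fin n) (S : Finset (Fin n)) : Set (Fin n → ℝ) :=
  {x | StrictBest i x ∧ (Finset.univ.filter fun j => x j < x i) = S}

theorem measurableSet_bestBelow {n : ℕ} (i : Fin n) (S : Finset (Fin n)) :
    MeasurableSet (bestBelow i S) := by
  refine MeasurableSet.inter (measurableSet_strictBest i) ?_
  change MeasurableSet {x : Fin n → ℝ | (Finset.univ.filter fun j => x j < x i) = S}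
  simp only [Finset.ext_iff, Finset.mem_filter, Finset.mem_univ, true_and, Set.ofPred_forall]
  refine .iInter fun j => ?_
  have h : MeasurableSet {x : Fin n → ℝ | x j < x i} :=
    measurableSet_lt (by fun_prop) (by fun_prop)
  by_cases hj : j ∈ S
  · simpa [hj] using h
  · have h' : MeasurableSet {x : Fin n → ℝ | x i ≤ x j} :=
      measurableSet_le (by fun_prop) (by fun_prop)
    simpa [hj] using h'

theorem measure_bestBelow {n : ℕ} (i : Fin n) {S : Finset (Fin n)} (hS : i ∉ S) :
    unifCube n (bestBelow i S) = unifCube n (bestBelow i ∅) := by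
  rw [← (measurePreserving_reflectOn S).measure_preimage
    (measurableSet_bestBelow i ∅).nullMeasurableSet]
  congr 1
  ext x
  have hb : StrictBest i (reflectOn S x) ↔ StrictBest i x := by
    simp only [StrictBest, abs_reflectOn_sub_half]
  simp only [bestBelow, Set.mem_preimage, Set.mem_ofPred_eq, hb]
  refine and_congr_right fun h => ?_
  simp only [Finset.ext_iff, Finset.mem_filter, Finset.mem_univ, true_and, Finset.notMem_empty,
    iff_false, not_lt]
  refine forall_congr' fun j => ?_
  by_cases hji : j = i
  · subst hji
    simp [hS]
  have hlt := h j hji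
  by_cases hj : j ∈ S
  · simp only [reflectOn, hS, hj, if_true, if_false, iff_true]
    rcases abs_cases (x i - 1 / 2) with ⟨h1, h2⟩ | ⟨h1, h2⟩ <;>
      rcases abs_cases (x j - 1 / 2) with ⟨h3, h4⟩ | ⟨h3, h4⟩ <;>
      constructor <;> intro h' <;> linarith
  · simp [reflectOn, hS, hj]

theorem measure_iUnion_bestBelow {n : ℕ} (F : Fin n → Finset (Finset (Fin n)))
    (hF : ∀ i, ∀ S ∈ F i, i ∉ S) :
    unifCube n {x | ∃ i, ∃ S ∈ F i, x ∈ bestBelow i S} =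
      ∑ i, (F i).card * unifCube n (bestBelow i ∅) := by
  have e : {x | ∃ i, ∃ S ∈ F i, x ∈ bestBelow i S} = ⋃ i, ⋃ S ∈ F i, bestBelow i S := by
    ext x
    simp
  have hm : ∀ i, MeasurableSet (⋃ S ∈ F i, bestBelow i S) := fun i =>
    Finset.measurableSet_biUnion _ fun S _ => measurableSet_bestBelow i S
  rw [e, measure_iUnion _ hm, tsum_fintype]
  · refine Finset.sum_congr rfl fun i _ => ?_
    rw [measure_biUnion_finset _ fun S _ => measurableSet_bestBelow i S]
    · rw [Finset.sum_congr rfl fun S hS => measure_bestBelow i (hF i S hS)]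
      simp
    · intro S _ T _ hne
      rw [Function.onFun, Set.disjoint_left]
      exact fun x hx hx' => hne (hx.2.symm.trans hx'.2)
  · intro i j hne
    rw [Function.onFun, Set.disjoint_left]
    intro x hx hx'
    simp only [Set.mem_iUnion] at hx hx'
    obtain ⟨S, _, hS⟩ := hx
    obtain ⟨T, _, hT⟩ := hx'
    exact hne (hS.1.unique hT.1)

theorem ae_exists_strictBest (N : ℕ) : ∀ᵐ x ∂unifCube (N + 1), ∃ i, StrictBest i x := by
  filter_upwards [ae_injective_abs_sub_half (N + 1)] with x hx
  obtain ⟨i, hi⟩ := Finite.exists_min fun i => |x i - 1 / 2|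
  exact ⟨i, fun j hj => lt_of_le_of_ne (hi j) fun h => hj (hx h).symm⟩

theorem two_pow_mul_sum_measure_bestBelow (N : ℕ) :
    2 ^ N * ∑ i : Fin (N + 1), unifCube (N + 1) (bestBelow i ∅) = 1 := by
  have h := measure_iUnion_bestBelow (n := N + 1) (fun i => (Finset.univ.erase i).powerset)
    (fun i S hS hi => by simpa using Finset.mem_powerset.1 hS hi)
  have h1 : unifCube (N + 1) {x | ∃ i,
      ∃ S ∈ ((Finset.univ : Finset (Fin (N + 1))).erase i).powerset, x ∈ bestBelow i S} = 1 := by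
    rw [← measure_univ (μ := unifCube (N + 1))]
    refine measure_congr ?_
    rw [ae_eq_univ, ← mem_ae_iff]
    filter_upwards [ae_exists_strictBest N] with x ⟨i, hi⟩
    refine ⟨i, _, ?_, hi, rfl⟩
    rw [Finset.mem_powerset]
    intro j hj
    simp only [Finset.mem_filter, Finset.mem_univ, true_and] at hj
    simp only [Finset.mem_erase, Finset.mem_univ, and_true]
    rintro rfl
    exact lt_irrefl _ hj
  rw [h1] at h
  rw [h, Finset.mul_sum]
  refine Finset.sum_congr rfl fun i _ => ?_
  simp

theorem factorial_mul_measure_sortedBest (N : ℕ) (k : Fin (N + 1)) :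
    ((N + 1).factorial : ENNReal) * unifCube (N + 1) (sortedBest (N + 1) k) =
      (N.choose k : ENNReal) * ∑ i : Fin (N + 1), unifCube (N + 1) (bestBelow i ∅) := by
  have h1 := measure_iUnion_sortedBest (n := N + 1) fun _ => k
  have h2 := measure_iUnion_bestBelow (n := N + 1)
    (fun i => (Finset.univ.erase i).powersetCard k)
    (fun i S hS hi => by simpa using (Finset.mem_powersetCard.1 hS).1 hi)
  have h3 : ∑ _σ : Equiv.Perm (Fin (N + 1)), unifCube (N + 1) (sortedBest (N + 1) k) =
      ((N + 1).factorial : ENNReal) * unifCube (N + 1) (sortedBest (N + 1) k) := by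
    simp [Fintype.card_perm]
  rw [← h3, ← h1, Finset.mul_sum]
  simp only [Finset.card_powersetCard, Finset.card_erase_of_mem (Finset.mem_univ _),
    Finset.card_univ, Fintype.card_fin, Nat.add_sub_cancel] at h2
  rw [← h2]
  refine measure_congr ?_
  filter_upwards [ae_injective_abs_sub_half (N + 1)] with x hx
  have hinj : Function.Injective x := fun i j h => hx (by simp [h])
  refine propext ?_
  change x ∈ (⋃ _, _) ↔ (∃ _, _)
  simp only [Set.mem_iUnion, Finset.mem_powersetCard]
  have hcard : ∀ (σ : Equiv.Perm (Fin (N + 1))), StrictMono (x ∘ σ.symm) →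
      ∀ i, (Finset.univ.filter fun j => x j < x i).card = σ i := by
    intro σ hσ i
    simp only [lt_iff_perm_lt hσ]
    exact card_perm_lt σ i
  constructor
  · rintro ⟨σ, hσ, hb⟩
    refine ⟨σ.symm k, _, ⟨?_, ?_⟩, (strictBest_comp_perm_symm σ _ x).1 (by simpa using hb), rfl⟩
    · intro j hj
      simp only [Finset.mem_filter, Finset.mem_univ, true_and] at hj
      simp only [Finset.mem_erase, Finset.mem_univ, and_true]
      rintro rfl
      exact lt_irrefl _ hj
    · rw [hcard σ hσ]
      simp
  · rintro ⟨i, S, ⟨-, hS⟩, hb, rfl⟩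
    obtain ⟨σ, hσ⟩ := exists_perm_strictMono_comp hinj
    refine ⟨σ, hσ, ?_⟩
    rw [hcard σ hσ] at hS
    rw [← Fin.ext hS]
    exact (strictBest_comp_perm_symm σ i x).2 hb

theorem measureReal_sortedBest (N : ℕ) (k : Fin (N + 1)) :
    (unifCube (N + 1) (sortedBest (N + 1) k)).toReal =
      (N.choose k : ℝ) / 2 ^ N / (N + 1).factorial := by
  have h1 := congrArg ENNReal.toReal (two_pow_mul_sum_measure_bestBelow N)
  have h2 := congrArg ENNReal.toReal (factorial_mul_measure_sortedBest N k)
  simp only [ENNReal.toReal_mul, ENNReal.toReal_pow, ENNReal.toReal_ofNat, ENNReal.toReal_one,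
    ENNReal.toReal_natCast] at h1 h2
  have hf : ((N + 1).factorial : ℝ) ≠ 0 := by positivity
  have h2N : (2 : ℝ) ^ N ≠ 0 := by positivity
  rw [div_div, eq_div_iff (by positivity)]
  linear_combination (2 : ℝ) ^ N * h2 + (N.choose k : ℝ) * h1

/-- The success probability of a rank-adapted rule is the average over all orderings of the
probability that the rank it stops on is the best one. -/
theorem success_probability_eq {N : ℕ} {τ : (Fin (N + 1) → ℝ) → Fin (N + 1)}
    (hτ : RankAdapted (N + 1) τ) :
    (unifCube (N + 1) {x | ∀ i, |x (τ x) - 1/2| ≤ |x i - 1/2|}).toReal =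
      (∑ σ : Equiv.Perm (Fin (N + 1)),
        (N.choose (σ (τ fun i => ((σ i : ℕ) : ℝ))) : ℝ) / 2 ^ N) / (N + 1).factorial := by
  have h := measure_iUnion_sortedBest (n := N + 1) fun σ => σ (τ fun i => ((σ i : ℕ) : ℝ))
  have e : unifCube (N + 1) {x | ∀ i, |x (τ x) - 1/2| ≤ |x i - 1/2|} =
      ∑ σ : Equiv.Perm (Fin (N + 1)), unifCube (N + 1)
        (sortedBest (N + 1) (σ (τ fun i => ((σ i : ℕ) : ℝ)))) := by
    rw [← h]
    refine measure_congr ?_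
    filter_upwards [ae_injective_abs_sub_half (N + 1)] with x hx
    have hinj : Function.Injective x := fun i j h => hx (by simp [h])
    refine propext ?_
    change (∀ _, _) ↔ x ∈ (⋃ _, _)
    simp only [Set.mem_iUnion, sortedBest, Set.mem_ofPred_eq, strictBest_comp_perm_symm]
    have hτσ : ∀ σ : Equiv.Perm (Fin (N + 1)), StrictMono (x ∘ σ.symm) →
        (τ fun i => ((σ i : ℕ) : ℝ)) = τ x := by
      intro σ hσ
      rw [hτ.2 (τ x) (fun i => ((σ i : ℕ) : ℝ)) x _ hinj]
      · intro i j _ _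
        rw [lt_iff_perm_lt hσ]
        simp
      · intro i j hij
        exact σ.injective (Fin.ext (Nat.cast_injective hij))
    constructor
    · intro hb
      obtain ⟨σ, hσ⟩ := exists_perm_strictMono_comp hinj
      refine ⟨σ, hσ, ?_⟩
      rw [hτσ σ hσ]
      exact fun j hj => lt_of_le_of_ne (hb j) fun h => hj (hx h).symm
    · rintro ⟨σ, hσ, hb⟩ i
      rw [hτσ σ hσ] at hb
      by_cases hi : i = τ x
      · rw [hi]
      · exact (hb i hi).le
  rw [e, ENNReal.toReal_sum fun _ _ => measure_ne_top _ _, Finset.sum_div]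
  exact Finset.sum_congr rfl fun σ _ => measureReal_sortedBest N _

theorem card_mul_sum_perm_apply {n : ℕ} (g : Fin n → ℝ) (i : Fin n) :
    (n : ℝ) * ∑ σ : Equiv.Perm (Fin n), g (σ i) = n.factorial * ∑ s, g s := by
  have h : ∀ j, ∑ σ : Equiv.Perm (Fin n), g (σ j) = ∑ σ : Equiv.Perm (Fin n), g (σ i) := by
    intro j
    rw [← Equiv.sum_comp (Equiv.mulRight (Equiv.swap i j))]
    simp
  calc (n : ℝ) * ∑ σ : Equiv.Perm (Fin n), g (σ i)
      = ∑ j, ∑ σ : Equiv.Perm (Fin n), g (σ j) := by simp [h]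
    _ = ∑ σ : Equiv.Perm (Fin n), ∑ s, g s := by
        rw [Finset.sum_comm]
        exact Finset.sum_congr rfl fun σ _ => Equiv.sum_comp σ g
    _ = n.factorial * ∑ s, g s := by simp [Fintype.card_perm]

theorem sum_perm_mul_nonpos {n : ℕ} {g : Fin n → ℝ} (hg : ∑ s, g s = 0) {i j : Fin n}
    (hij : i ≠ j) : ∑ σ : Equiv.Perm (Fin n), g (σ i) * g (σ j) ≤ 0 := by
  have h : ∀ k ∈ Finset.univ.erase i, ∑ σ : Equiv.Perm (Fin n), g (σ i) * g (σ k) =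
      ∑ σ : Equiv.Perm (Fin n), g (σ i) * g (σ j) := by
    intro k hk
    rw [← Equiv.sum_comp (Equiv.mulRight (Equiv.swap j k))]
    simp [Equiv.swap_apply_of_ne_of_ne hij (Finset.ne_of_mem_erase hk).symm]
  have h2 : ∑ k ∈ Finset.univ.erase i, ∑ σ : Equiv.Perm (Fin n), g (σ i) * g (σ k) ≤ 0 := by
    rw [Finset.sum_comm]
    refine Finset.sum_nonpos fun σ _ => ?_
    rw [← Finset.mul_sum]
    have h3 := Finset.add_sum_erase Finset.univ (fun k => g (σ k)) (Finset.mem_univ i)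
    rw [Equiv.sum_comp σ g, hg] at h3
    rw [eq_neg_of_add_eq_zero_right h3]
    nlinarith [sq_nonneg (g (σ i))]
  rw [Finset.sum_congr rfl h, Finset.sum_const, nsmul_eq_mul] at h2
  have hpos : 0 < (Finset.univ.erase i).card :=
    Finset.card_pos.2 ⟨j, Finset.mem_erase.2 ⟨hij.symm, Finset.mem_univ _⟩⟩
  by_contra hc
  exact absurd h2 (not_le.2 (mul_pos (by exact_mod_cast hpos) (not_le.1 hc)))

theorem sum_perm_sq_sum_le {n : ℕ} {g : Fin n → ℝ} (hg : ∑ s, g s = 0) (A : Finset (Fin n)) :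
    (n : ℝ) * ∑ σ : Equiv.Perm (Fin n), (∑ i ∈ A, g (σ i)) ^ 2 ≤
      A.card * (n.factorial * ∑ s, g s ^ 2) := by
  have h1 : ∑ σ : Equiv.Perm (Fin n), (∑ i ∈ A, g (σ i)) ^ 2 ≤
      ∑ i ∈ A, ∑ σ : Equiv.Perm (Fin n), g (σ i) ^ 2 := by
    calc ∑ σ : Equiv.Perm (Fin n), (∑ i ∈ A, g (σ i)) ^ 2
        = ∑ i ∈ A, ∑ j ∈ A, ∑ σ : Equiv.Perm (Fin n), g (σ i) * g (σ j) := by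
          simp only [sq, Finset.sum_mul_sum]
          rw [Finset.sum_comm]
          exact Finset.sum_congr rfl fun i _ => Finset.sum_comm
      _ ≤ ∑ i ∈ A, ∑ σ : Equiv.Perm (Fin n), g (σ i) ^ 2 := by
          refine Finset.sum_le_sum fun i hi => ?_
          rw [← Finset.add_sum_erase A _ hi]
          have : ∑ j ∈ A.erase i, ∑ σ : Equiv.Perm (Fin n), g (σ i) * g (σ j) ≤ 0 :=
            Finset.sum_nonpos fun j hj => sum_perm_mul_nonpos hg (Finset.ne_of_mem_erase hj).symm
          simp only [sq]
          linarith
  calc (n : ℝ) * ∑ σ : Equiv.Perm (Fin n), (∑ i ∈ A, g (σ i)) ^ 2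
      ≤ n * ∑ i ∈ A, ∑ σ : Equiv.Perm (Fin n), g (σ i) ^ 2 := by gcongr
    _ = A.card * (n.factorial * ∑ s, g s ^ 2) := by
        rw [Finset.mul_sum,
          Finset.sum_congr rfl fun i _ => card_mul_sum_perm_apply (fun s => g s ^ 2) i]
        simp

/-- Chebyshev's inequality for the hypergeometric distribution. -/
theorem card_perm_deviation_le {n : ℕ} (hn : 0 < n) (A W : Finset (Fin n)) {δ : ℝ} (hδ : 0 < δ) :
    ((Finset.univ.filter fun σ : Equiv.Perm (Fin n) =>
      δ ≤ |((A.filter fun i => σ i ∈ W).card : ℝ) - A.card * W.card / n|).card : ℝ) ≤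
      n.factorial * (A.card * W.card / n / δ ^ 2) := by
  have hn' : (0 : ℝ) < n := by exact_mod_cast hn
  set g : Fin n → ℝ := fun s => (if s ∈ W then 1 else 0) - W.card / n with hg
  have hg0 : ∑ s, g s = 0 := by
    simp only [hg, Finset.sum_sub_distrib, Finset.sum_ite_mem, Finset.univ_inter, Finset.sum_const,
      Finset.card_univ, Fintype.card_fin, nsmul_eq_mul]
    field_simp
    ring
  have hg2 : ∑ s, g s ^ 2 ≤ W.card := by
    have e : ∀ s, g s ^ 2 = (if s ∈ W then 1 else 0) - 2 * (W.card / n) * g s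
        - (W.card / n : ℝ) ^ 2 := by
      intro s
      simp only [hg]
      split_ifs <;> ring
    simp only [e, Finset.sum_sub_distrib, ← Finset.mul_sum, hg0, Finset.sum_ite_mem,
      Finset.univ_inter, Finset.sum_const, nsmul_eq_mul]
    have : 0 ≤ ((Finset.univ : Finset (Fin n)).card : ℝ) * (W.card / n : ℝ) ^ 2 := by positivity
    linarith
  have hsum : ∀ σ : Equiv.Perm (Fin n), ∑ i ∈ A, g (σ i) =
      ((A.filter fun i => σ i ∈ W).card : ℝ) - A.card * W.card / n := by
    intro σ
    simp only [hg, Finset.sum_sub_distrib, Finset.sum_boole, Finset.sum_const, nsmul_eq_mul]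
    ring
  have h1 := sum_perm_sq_sum_le hg0 A
  set B := Finset.univ.filter fun σ : Equiv.Perm (Fin n) =>
      δ ≤ |((A.filter fun i => σ i ∈ W).card : ℝ) - A.card * W.card / n| with hB
  have h2 : (B.card : ℝ) * δ ^ 2 ≤ ∑ σ : Equiv.Perm (Fin n), (∑ i ∈ A, g (σ i)) ^ 2 := by
    calc (B.card : ℝ) * δ ^ 2 = ∑ _σ ∈ B, δ ^ 2 := by simp
      _ ≤ ∑ σ ∈ B, (∑ i ∈ A, g (σ i)) ^ 2 := by
          refine Finset.sum_le_sum fun σ hσ => ?_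
          rw [hsum, ← sq_abs (_ - _)]
          gcongr
          exact (Finset.mem_filter.1 hσ).2
      _ ≤ _ := Finset.sum_le_sum_of_subset_of_nonneg (Finset.subset_univ _)
          fun _ _ _ => sq_nonneg _
  have h3 : (n : ℝ) * (B.card * δ ^ 2) ≤ A.card * (n.factorial * W.card) := by
    calc (n : ℝ) * (B.card * δ ^ 2) ≤ _ := by gcongr
      _ ≤ _ := h1
      _ ≤ _ := by gcongr
  have h4 : (n.factorial : ℝ) * (A.card * W.card / n / δ ^ 2) =
      A.card * (n.factorial * W.card) / (n * δ ^ 2) := by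
    field_simp
  rw [h4, le_div_iff₀ (by positivity)]
  linarith

/-- The number of the first `t` observations lying below the `i`-th one. -/
noncomputable def sampleCount {n : ℕ} (t : ℕ) (x : Fin n → ℝ) (i : Fin n) : ℕ :=
  (Finset.univ.filter fun j : Fin n => (j : ℕ) < t ∧ x j < x i).card

/-- An observation is accepted if it comes after the first `t` ones and the number of these below
it lies between `a` and `b`. -/
def Accepts {n : ℕ} (t : ℕ) (a b : ℝ) (x : Fin n → ℝ) (i : Fin n) : Prop :=
  t ≤ i ∧ a < sampleCount t x i ∧ sampleCount t x i < b

open Classical in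
/-- Stop at the first accepted observation, or at the end if there is none. -/
noncomputable def windowRule (N t : ℕ) (a b : ℝ) (x : Fin (N + 1) → ℝ) : Fin (N + 1) :=
  (Finset.univ.filter fun i => Accepts t a b x i ∨ i = Fin.last N).min'
    (Finset.filter_nonempty_iff.2 ⟨Fin.last N, by simp⟩)

theorem windowRule_eq_iff {N t : ℕ} {a b : ℝ} {x : Fin (N + 1) → ℝ} {s : Fin (N + 1)} :
    windowRule N t a b x = s ↔ (Accepts t a b x s ∨ s = Fin.last N) ∧
      ∀ r < s, ¬ (Accepts t a b x r ∨ r = Fin.last N) := by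
  classical
  rw [windowRule, Finset.min'_eq_iff]
  simp only [Finset.mem_filter, Finset.mem_univ, true_and]
  refine and_congr_right fun _ => forall_congr' fun r => ?_
  rw [← not_lt]
  exact ⟨fun h h1 h2 => h h2 h1, fun h h1 h2 => h h2 h1⟩

theorem accepts_windowRule {N t : ℕ} {a b : ℝ} {x : Fin (N + 1) → ℝ}
    (h : ∃ i, Accepts t a b x i) : Accepts t a b x (windowRule N t a b x) := by
  obtain ⟨i, hi⟩ := h
  obtain ⟨h1, h2⟩ := windowRule_eq_iff.1 (rfl : windowRule N t a b x = windowRule N t a b x)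
  rcases h1 with h1 | h1
  · exact h1
  · have hle : windowRule N t a b x ≤ i := not_lt.1 fun hlt => h2 i hlt (Or.inl hi)
    rw [h1] at hle ⊢
    rwa [← Fin.last_le_iff.1 hle]

theorem accepts_congr {n t : ℕ} {a b : ℝ} {x x' : Fin n → ℝ} {s : Fin n}
    (h : ∀ i j : Fin n, i ≤ s → j ≤ s → (x i < x j ↔ x' i < x' j)) :
    Accepts t a b x s ↔ Accepts t a b x' s := by
  refine and_congr_right fun ht => ?_
  have : sampleCount t x s = sampleCount t x' s := by
    unfold sampleCount
    congr 1
    refine Finset.filter_congr fun j _ => and_congr_right fun hj => h j s ?_ le_rfl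
    exact Fin.le_def.2 (hj.le.trans ht)
  rw [this]

theorem measurable_windowRule (N t : ℕ) (a b : ℝ) : Measurable (windowRule N t a b) := by
  have hA : ∀ s, MeasurableSet {x : Fin (N + 1) → ℝ | Accepts t a b x s} := by
    intro s
    have hR : Measurable fun x : Fin (N + 1) → ℝ => fun i j => x i < x j := by
      refine measurable_pi_lambda _ fun i => measurable_pi_lambda _ fun j => ?_
      exact measurableSet_setOfPred.1 (measurableSet_lt (by fun_prop) (by fun_prop))
    have hD : {x : Fin (N + 1) → ℝ | Accepts t a b x s} =
        (fun x : Fin (N + 1) → ℝ => fun i j => x i < x j) ⁻¹'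
          (Set.image (fun x : Fin (N + 1) → ℝ => fun i j => x i < x j) {x | Accepts t a b x s}) := by
      refine (Set.subset_preimage_image _ _).antisymm ?_
      rintro x ⟨x', hx', he⟩
      refine (accepts_congr fun i j _ _ => ?_).1 hx'
      exact iff_of_eq (congrFun (congrFun he i) j)
    rw [hD]
    exact hR (Set.toFinite _).measurableSet
  refine measurable_to_countable' fun s => ?_
  have e : windowRule N t a b ⁻¹' {s} = {x | (Accepts t a b x s ∨ s = Fin.last N) ∧
      ∀ r < s, ¬ (Accepts t a b x r ∨ r = Fin.last N)} := by
    ext x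
    exact windowRule_eq_iff
  have hP : ∀ s, MeasurableSet {x : Fin (N + 1) → ℝ | Accepts t a b x s ∨ s = Fin.last N} :=
    fun s => (hA s).union (.const _)
  rw [e]
  refine (hP s).inter ?_
  change MeasurableSet {x | ∀ r < s, ¬ (Accepts t a b x r ∨ r = Fin.last N)}
  simp only [Set.ofPred_forall]
  exact .iInter fun r => .iInter fun _ => (hP r).compl

theorem rankAdapted_windowRule (N t : ℕ) (a b : ℝ) : RankAdapted (N + 1) (windowRule N t a b) := by
  refine ⟨measurable_windowRule N t a b, fun s x x' _ _ h => ?_⟩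
  rw [windowRule_eq_iff, windowRule_eq_iff]
  have hA : ∀ r ≤ s, (Accepts t a b x r ↔ Accepts t a b x' r) := fun r hr =>
    accepts_congr fun i j hi hj => h i j (hi.trans hr) (hj.trans hr)
  rw [hA s le_rfl]
  refine and_congr_right fun _ => forall_congr' fun r => ?_
  refine forall_congr' fun hr => ?_
  rw [hA r hr.le]

/-- The observations with index at least `t`. -/
def lateIndices (n t : ℕ) : Finset (Fin n) := Finset.univ.filter fun i => t ≤ (i : ℕ)

/-- The number of late observations whose final rank is less than `r`. -/
def lateCount {n : ℕ} (t : ℕ) (σ : Equiv.Perm (Fin n)) (r : ℕ) : ℕ :=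
  ((lateIndices n t).filter fun i => (σ i : ℕ) < r).card

theorem card_val_lt {n r : ℕ} (hr : r ≤ n) :
    (Finset.univ.filter fun s : Fin n => (s : ℕ) < r).card = r := by
  rw [Fin.card_filter_val_lt, min_eq_right hr]

theorem card_early_add_lateCount {n t r : ℕ} (hr : r ≤ n) (σ : Equiv.Perm (Fin n)) :
    (Finset.univ.filter fun j : Fin n => (j : ℕ) < t ∧ (σ j : ℕ) < r).card + lateCount t σ r = r := by
  have h1 : (Finset.univ.filter fun j : Fin n => (σ j : ℕ) < r).card = r := by
    have : (Finset.univ.filter fun j : Fin n => (σ j : ℕ) < r) =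
        (Finset.univ.filter fun s : Fin n => (s : ℕ) < r).map σ.symm.toEmbedding := by
      ext j
      simp [Finset.mem_map_equiv]
    rw [this, Finset.card_map, card_val_lt hr]
  conv_rhs => rw [← h1]
  rw [← Finset.card_filter_add_card_filter_not (s := Finset.univ.filter fun j : Fin n =>
    (σ j : ℕ) < r) (fun j => (j : ℕ) < t), lateCount, lateIndices, Finset.filter_filter,
    Finset.filter_filter, Finset.filter_filter]
  simp only [not_lt, and_comm]

theorem windowRule_rank_mem {N m r₁ r₂ r₃ r₄ : ℕ} {δ : ℝ} {σ : Equiv.Perm (Fin (N + 1))}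
    (h4 : r₄ ≤ N + 1) (h2 : r₂ ≤ N + 1) (h31 : r₃ ≤ N + 1) (h1 : r₁ ≤ N + 1)
    (hr₁ : |(lateCount (N + 1 - m) σ r₁ : ℝ) - m * r₁ / (N + 1 : ℕ)| < δ)
    (hr₂ : |(lateCount (N + 1 - m) σ r₂ : ℝ) - m * r₂ / (N + 1 : ℕ)| < δ)
    (hr₃ : |(lateCount (N + 1 - m) σ r₃ : ℝ) - m * r₃ / (N + 1 : ℕ)| < δ)
    (hr₄ : |(lateCount (N + 1 - m) σ r₄ : ℝ) - m * r₄ / (N + 1 : ℕ)| < δ)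
    (h13 : 2 * δ ≤ ((r₃ : ℝ) - r₁) * (1 - m / (N + 1 : ℕ)))
    (h42 : 2 * δ ≤ ((r₂ : ℝ) - r₄) * (1 - m / (N + 1 : ℕ)))
    (hw : ∃ i ∈ lateIndices (N + 1) (N + 1 - m), r₃ ≤ (σ i : ℕ) ∧ (σ i : ℕ) < r₄) :
    r₁ < (σ (windowRule N (N + 1 - m) (r₁ * (1 - m / (N + 1 : ℕ)) + δ)
        (r₂ * (1 - m / (N + 1 : ℕ)) - δ) fun i => ((σ i : ℕ) : ℝ)) : ℕ) ∧
      (σ (windowRule N (N + 1 - m) (r₁ * (1 - m / (N + 1 : ℕ)) + δ)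
        (r₂ * (1 - m / (N + 1 : ℕ)) - δ) fun i => ((σ i : ℕ) : ℝ)) : ℕ) < r₂ := by
  set t := N + 1 - m
  set a : ℝ := r₁ * (1 - m / (N + 1 : ℕ)) + δ with ha
  set b : ℝ := r₂ * (1 - m / (N + 1 : ℕ)) - δ with hb
  set y : Fin (N + 1) → ℝ := fun i => ((σ i : ℕ) : ℝ) with hy
  set c : ℕ → ℕ := fun r =>
    (Finset.univ.filter fun j : Fin (N + 1) => (j : ℕ) < t ∧ (σ j : ℕ) < r).card with hc
  have hsc : ∀ i, sampleCount t y i = c (σ i) := by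
    intro i
    simp only [sampleCount, hy, hc, Nat.cast_lt]
  have hcmono : Monotone c := by
    intro r r' hrr'
    refine Finset.card_le_card fun j hj => ?_
    simp only [Finset.mem_filter, Finset.mem_univ, true_and] at hj ⊢
    exact ⟨hj.1, hj.2.trans_le hrr'⟩
  have hcr : ∀ r ≤ N + 1, (c r : ℝ) + lateCount t σ r = r := by
    intro r hr
    exact_mod_cast card_early_add_lateCount hr σ
  have hc1 := hcr r₁ h1
  have hc2 := hcr r₂ h2
  have hc3 := hcr r₃ h31
  have hc4 := hcr r₄ h4
  rw [abs_lt] at hr₁ hr₂ hr₃ hr₄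
  have hdiv : ∀ r : ℕ, (m : ℝ) * r / (N + 1 : ℕ) = r * (m / (N + 1 : ℕ)) := fun r => by ring
  rw [hdiv] at hr₁ hr₂ hr₃ hr₄
  have hacc : Accepts t a b y (windowRule N t a b y) := by
    refine accepts_windowRule ?_
    obtain ⟨i, hi, hi3, hi4⟩ := hw
    refine ⟨i, (Finset.mem_filter.1 hi).2, ?_, ?_⟩
    · rw [hsc]
      have : (c r₃ : ℝ) ≤ c (σ i) := by exact_mod_cast hcmono hi3
      linarith
    · rw [hsc]
      have : (c (σ i) : ℝ) ≤ c r₄ := by exact_mod_cast hcmono hi4.le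
      linarith
  obtain ⟨-, hlo, hhi⟩ := hacc
  rw [hsc] at hlo hhi
  constructor
  · by_contra hcon
    have : (c (σ (windowRule N t a b y)) : ℝ) ≤ c r₁ := by
      exact_mod_cast hcmono (not_lt.1 hcon)
    linarith
  · by_contra hcon
    have : (c r₂ : ℝ) ≤ c (σ (windowRule N t a b y)) := by
      exact_mod_cast hcmono (not_lt.1 hcon)
    linarith

theorem choose_middle_add_ge (N j : ℕ) :
    (N.choose (N / 2) : ℝ) * (1 - (j : ℝ) ^ 2 / ((N / 2 : ℕ) + 1)) ≤ N.choose (N / 2 + j) := by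
  induction j with
  | zero => simp
  | succ j ih =>
    set h := N / 2
    have hmid : (N.choose (h + j) : ℝ) ≤ N.choose h := by
      exact_mod_cast Nat.choose_le_middle (h + j) N
    have hrec : (N.choose (h + (j + 1)) : ℝ) * (h + j + 1) =
        N.choose (h + j) * ((N - (h + j) : ℕ) : ℝ) := by
      exact_mod_cast Nat.choose_succ_right_eq N (h + j)
    have hsub : (h : ℝ) - j ≤ ((N - (h + j) : ℕ) : ℝ) := by
      rw [sub_le_iff_le_add]
      have : h ≤ N - (h + j) + j := by lia
      exact_mod_cast this
    have hC : (0 : ℝ) ≤ N.choose (h + j) := by positivity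
    have hstep : (N.choose (h + j) : ℝ) * (1 - (2 * j + 1) / (h + j + 1)) ≤
        N.choose (h + (j + 1)) := by
      have e : (1 : ℝ) - (2 * j + 1) / (h + j + 1) = (h - j) / (h + j + 1) := by
        field_simp
        ring
      rw [e, mul_div_assoc', div_le_iff₀ (by positivity), hrec]
      gcongr
    have hfrac : (2 * (j : ℝ) + 1) / (h + j + 1) ≤ (2 * j + 1) / (h + 1) := by
      gcongr
      linarith [(Nat.cast_nonneg j : (0 : ℝ) ≤ j)]
    have hprod : (N.choose (h + j) : ℝ) * ((2 * j + 1) / (h + j + 1)) ≤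
        N.choose h * ((2 * j + 1) / (h + 1)) := by gcongr
    have e : (((j + 1 : ℕ) : ℝ)) ^ 2 / (h + 1) = (j : ℝ) ^ 2 / (h + 1) + (2 * j + 1) / (h + 1) := by
      push_cast
      ring
    rw [e]
    linarith

theorem choose_near_middle_ge {N k r : ℕ} (h1 : N / 2 - r < k) (h2 : k < N / 2 + r) :
    (N.choose (N / 2) : ℝ) * (1 - (r : ℝ) ^ 2 / ((N / 2 : ℕ) + 1)) ≤ N.choose k := by
  have main : ∀ k', N / 2 ≤ k' → k' ≤ N / 2 + r →
      (N.choose (N / 2) : ℝ) * (1 - (r : ℝ) ^ 2 / ((N / 2 : ℕ) + 1)) ≤ N.choose k' := by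
    intro k' hk' hk'r
    obtain ⟨j, rfl⟩ := Nat.exists_eq_add_of_le hk'
    refine le_trans ?_ (choose_middle_add_ge N j)
    have : (j : ℝ) ≤ r := by exact_mod_cast (by lia : j ≤ r)
    gcongr
  rcases le_total (N / 2) k with h | h
  · exact main k h h2.le
  · rw [← Nat.choose_symm (by lia : k ≤ N)]
    exact main _ (by lia) (by lia)

theorem bddAbove_success (n : ℕ) : BddAbove {p : ℝ | ∃ τ : (Fin n → ℝ) → Fin n,
    RankAdapted n τ ∧ p = (unifCube n {x | ∀ i, |x (τ x) - 1/2| ≤ |x i - 1/2|}).toReal} := by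
  refine ⟨1, ?_⟩
  rintro p ⟨τ, -, rfl⟩
  exact ENNReal.toReal_le_of_le_ofReal zero_le_one (by simpa using prob_le_one)

theorem V_le (N : ℕ) : V (N + 1) ≤ (N.choose (N / 2) : ℝ) / 2 ^ N := by
  refine Real.sSup_le ?_ (by positivity)
  rintro p ⟨τ, hτ, rfl⟩
  rw [success_probability_eq hτ, div_le_iff₀ (by positivity)]
  calc _ ≤ ∑ _σ : Equiv.Perm (Fin (N + 1)), (N.choose (N / 2) : ℝ) / 2 ^ N := by
        refine Finset.sum_le_sum fun σ _ => ?_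
        gcongr
        exact Nat.choose_le_middle _ _
    _ = _ := by
        simp only [Finset.sum_const, Finset.card_univ, Fintype.card_perm, Fintype.card_fin,
          nsmul_eq_mul]
        ring

theorem card_lateIndices {n m : ℕ} (hm : m ≤ n) : (lateIndices n (n - m)).card = m := by
  have h := Finset.card_filter_add_card_filter_not (s := (Finset.univ : Finset (Fin n)))
    (fun i => (i : ℕ) < n - m)
  rw [card_val_lt (Nat.sub_le n m), Finset.card_univ, Fintype.card_fin] at h
  simp only [not_lt] at h
  unfold lateIndices
  lia

theorem card_perm_lateCount_deviation_le {n m r : ℕ} (hn : 0 < n) (hm : m ≤ n) (hr : r ≤ n)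
    {δ : ℝ} (hδ : 0 < δ) :
    ((Finset.univ.filter fun σ : Equiv.Perm (Fin n) =>
      δ ≤ |(lateCount (n - m) σ r : ℝ) - m * r / n|).card : ℝ) ≤ n.factorial * (m / δ ^ 2) := by
  have h := card_perm_deviation_le hn (lateIndices n (n - m))
    (Finset.univ.filter fun s : Fin n => (s : ℕ) < r) hδ
  rw [card_lateIndices hm, card_val_lt hr] at h
  simp only [Finset.mem_filter, Finset.mem_univ, true_and] at h
  refine h.trans ?_
  have hn' : (0 : ℝ) < n := by exact_mod_cast hn
  gcongr
  rw [div_le_iff₀ hn']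
  gcongr

theorem card_perm_no_late_le {n m r w : ℕ} (hm0 : 0 < m) (hm : m ≤ n) (hw : 0 < w)
    (hr : r + w ≤ n) :
    ((Finset.univ.filter fun σ : Equiv.Perm (Fin n) =>
      ¬ ∃ i ∈ lateIndices n (n - m), r ≤ (σ i : ℕ) ∧ (σ i : ℕ) < r + w).card : ℝ) ≤
      n.factorial * (n / (m * w)) := by
  have hn' : (0 : ℝ) < n := by exact_mod_cast hm0.trans_le hm
  have hm' : (0 : ℝ) < m := by exact_mod_cast hm0
  have hw' : (0 : ℝ) < w := by exact_mod_cast hw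
  set W := Finset.univ.filter fun s : Fin n => r ≤ (s : ℕ) ∧ (s : ℕ) < r + w with hW
  have hWc : W.card = w := by
    have h := Finset.card_filter_add_card_filter_not
      (s := Finset.univ.filter fun s : Fin n => (s : ℕ) < r + w) (fun s => (s : ℕ) < r)
    rw [card_val_lt hr, Finset.filter_filter, Finset.filter_filter] at h
    have e1 : (Finset.univ.filter fun s : Fin n => (s : ℕ) < r + w ∧ (s : ℕ) < r) =
        Finset.univ.filter fun s : Fin n => (s : ℕ) < r :=
      Finset.filter_congr fun s _ => by lia
    have e2 : (Finset.univ.filter fun s : Fin n => (s : ℕ) < r + w ∧ ¬ (s : ℕ) < r) = W :=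
      Finset.filter_congr fun s _ => by lia
    rw [e1, e2, card_val_lt (by lia)] at h
    lia
  have h := card_perm_deviation_le (hm0.trans_le hm) (lateIndices n (n - m)) W
    (δ := (m : ℝ) * w / n) (by positivity)
  rw [card_lateIndices hm, hWc] at h
  refine le_trans ?_ (h.trans (le_of_eq ?_))
  · norm_cast
    refine Finset.card_le_card fun σ hσ => ?_
    simp only [Finset.mem_filter, Finset.mem_univ, true_and] at hσ ⊢
    have h0 : ((lateIndices n (n - m)).filter fun i => σ i ∈ W) = ∅ := by
      refine Finset.filter_eq_empty_iff.2 fun i hi hmem => hσ ⟨i, hi, ?_⟩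
      simpa [hW] using hmem
    rw [h0, Finset.card_empty, Nat.cast_zero, zero_sub, abs_neg]
    exact le_abs_self _
  · field_simp

theorem le_V {N m d : ℕ} (hd : 0 < d) (hm : 0 < m) (hmN : 2 * m ≤ N + 1) (hdN : 2 * d ≤ N / 2)
    (hd2 : ((2 * d : ℕ) : ℝ) ^ 2 / ((N / 2 : ℕ) + 1) ≤ 1) :
    (1 - (100 * (m / (d : ℝ) ^ 2) + (N + 1 : ℕ) / (m * (2 * d : ℕ)))) *
      ((N.choose (N / 2) : ℝ) * (1 - ((2 * d : ℕ) : ℝ) ^ 2 / ((N / 2 : ℕ) + 1)) / 2 ^ N) ≤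
      V (N + 1) := by
  classical
  set h := N / 2 with hh
  have hd' : (0 : ℝ) < d := by exact_mod_cast hd
  set δ : ℝ := d / 5 with hδ
  have hδ0 : 0 < δ := by positivity
  set c : ℝ := (N.choose h : ℝ) * (1 - ((2 * d : ℕ) : ℝ) ^ 2 / (h + 1)) with hc
  have hc0 : 0 ≤ c := mul_nonneg (by positivity) (sub_nonneg.2 hd2)
  set a : ℝ := ((h - 2 * d : ℕ) : ℝ) * (1 - m / (N + 1 : ℕ)) + δ
  set b : ℝ := ((h + 2 * d : ℕ) : ℝ) * (1 - m / (N + 1 : ℕ)) - δ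
  set τ := windowRule N (N + 1 - m) a b
  refine le_trans ?_ (le_csSup (bddAbove_success (N + 1)) ⟨τ, rankAdapted_windowRule _ _ _ _, rfl⟩)
  rw [success_probability_eq (rankAdapted_windowRule _ _ _ _), le_div_iff₀ (by positivity)]
  set dev : ℕ → Finset (Equiv.Perm (Fin (N + 1))) := fun r =>
    Finset.univ.filter fun σ => δ ≤ |(lateCount (N + 1 - m) σ r : ℝ) - m * r / (N + 1 : ℕ)|
    with hdev
  set nl : Finset (Equiv.Perm (Fin (N + 1))) := Finset.univ.filter fun σ =>
    ¬ ∃ i ∈ lateIndices (N + 1) (N + 1 - m),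
      h - d ≤ (σ i : ℕ) ∧ (σ i : ℕ) < h - d + 2 * d with hnl
  set bad := dev (h - 2 * d) ∪ (dev (h + 2 * d) ∪ (dev (h - d) ∪ (dev (h - d + 2 * d) ∪ nl)))
    with hbad
  have hdevle : ∀ r ≤ N + 1, ((dev r).card : ℝ) ≤ (N + 1).factorial * (m / δ ^ 2) := fun r hr =>
    card_perm_lateCount_deviation_le (Nat.succ_pos N) (by lia) hr hδ0
  have hnlle : (nl.card : ℝ) ≤ (N + 1).factorial * ((N + 1 : ℕ) / (m * (2 * d : ℕ))) :=
    card_perm_no_late_le hm (by lia) (by lia) (by lia)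
  have hbadle : (bad.card : ℝ) ≤
      (N + 1).factorial * (100 * (m / (d : ℝ) ^ 2) + (N + 1 : ℕ) / (m * (2 * d : ℕ))) := by
    have h1 : bad.card ≤ (dev (h - 2 * d)).card + ((dev (h + 2 * d)).card + ((dev (h - d)).card +
        ((dev (h - d + 2 * d)).card + nl.card))) := by
      rw [hbad]
      iterate 4 refine (Finset.card_union_le _ _).trans (Nat.add_le_add_left ?_ _)
      exact le_rfl
    have h1' : (bad.card : ℝ) ≤ (dev (h - 2 * d)).card + ((dev (h + 2 * d)).card +
        ((dev (h - d)).card + ((dev (h - d + 2 * d)).card + nl.card))) := by exact_mod_cast h1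
    have e : 100 * (m / (d : ℝ) ^ 2) = 4 * (m / δ ^ 2) := by
      rw [hδ]
      field_simp
      norm_num
    rw [e]
    linarith [hdevle (h - 2 * d) (by lia), hdevle (h + 2 * d) (by lia), hdevle (h - d) (by lia),
      hdevle (h - d + 2 * d) (by lia)]
  have hgood : ∀ σ ∈ badᶜ, c / 2 ^ N ≤
      (N.choose (σ (τ fun i => ((σ i : ℕ) : ℝ))) : ℝ) / 2 ^ N := by
    intro σ hσ
    simp only [hbad, hdev, hnl, Finset.mem_compl, Finset.mem_union, Finset.mem_filter,
      Finset.mem_univ, true_and, not_or, not_le, not_not] at hσ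
    obtain ⟨g1, g2, g3, g4, g5⟩ := hσ
    have hfrac : (m : ℝ) / (N + 1 : ℕ) ≤ 1 / 2 := by
      rw [div_le_div_iff₀ (by positivity) (by norm_num)]
      exact_mod_cast (by lia : m * 2 ≤ 1 * (N + 1))
    have hmul : 2 * δ ≤ (d : ℝ) * (1 - m / (N + 1 : ℕ)) := by
      rw [hδ]
      nlinarith
    have hrank := windowRule_rank_mem (by lia) (by lia) (by lia) (by lia) g1 g2 g3 g4
      (by
        have : ((h - d : ℕ) : ℝ) - (h - 2 * d : ℕ) = d := by
          rw [Nat.cast_sub (by lia), Nat.cast_sub (by lia)]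
          push_cast
          ring
        rwa [this])
      (by
        have : ((h + 2 * d : ℕ) : ℝ) - (h - d + 2 * d : ℕ) = d := by
          push_cast [Nat.cast_sub (by lia : d ≤ h)]
          ring
        rwa [this]) g5
    have := choose_near_middle_ge hrank.1 hrank.2
    gcongr
  have hcompl : (badᶜ.card : ℝ) = (N + 1).factorial - bad.card := by
    rw [Finset.card_compl, Nat.cast_sub (Finset.card_le_univ _), Fintype.card_perm,
      Fintype.card_fin]
  calc _ = ((N + 1).factorial - (N + 1).factorial *
          (100 * (m / (d : ℝ) ^ 2) + (N + 1 : ℕ) / (m * (2 * d : ℕ)))) * (c / 2 ^ N) := by ring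
    _ ≤ badᶜ.card * (c / 2 ^ N) := by
        gcongr
        linarith
    _ = ∑ _σ ∈ badᶜ, c / 2 ^ N := by simp
    _ ≤ ∑ σ ∈ badᶜ, (N.choose (σ (τ fun i => ((σ i : ℕ) : ℝ))) : ℝ) / 2 ^ N :=
        Finset.sum_le_sum hgood
    _ ≤ _ := Finset.sum_le_sum_of_subset_of_nonneg (Finset.subset_univ _)
        fun _ _ _ => by positivity

theorem centralBinom_sq_mul_wallis (k : ℕ) :
    ((k.centralBinom : ℝ) / 4 ^ k) ^ 2 * (Real.Wallis.W k * (2 * k + 1)) = 1 := by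
  have h : (k.centralBinom : ℝ) * (k.factorial * k.factorial) = (2 * k).factorial := by
    have := Nat.choose_mul_factorial_mul_factorial (by lia : k ≤ 2 * k)
    rw [show 2 * k - k = k by lia, mul_assoc] at this
    exact_mod_cast this
  rw [Real.Wallis.W_eq_factorial_ratio, ← h]
  have h4 : (4 : ℝ) ^ k = 2 ^ (2 * k) := by rw [pow_mul]; norm_num
  have hk : (k.factorial : ℝ) ≠ 0 := by positivity
  have hc : (k.centralBinom : ℝ) ≠ 0 := by exact_mod_cast k.centralBinom_ne_zero
  rw [h4]
  field_simp
  ring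

theorem choose_middle_div_two_pow (N : ℕ) :
    (N.choose (N / 2) : ℝ) / 2 ^ N = ((N + 1) / 2).centralBinom / 4 ^ ((N + 1) / 2) := by
  obtain ⟨k, rfl | rfl⟩ := Nat.even_or_odd' N
  · rw [show 2 * k / 2 = k by lia, show (2 * k + 1) / 2 = k by lia, pow_mul, Nat.centralBinom]
    norm_num
  · rw [show (2 * k + 1) / 2 = k by lia, show (2 * k + 1 + 1) / 2 = k + 1 by lia]
    have h : (k + 1).centralBinom = 2 * (2 * k + 1).choose k := by
      rw [Nat.centralBinom, show 2 * (k + 1) = 2 * k + 1 + 1 by lia, Nat.choose_succ_succ,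
        Nat.choose_symm_half]
      lia
    have h4 : (4 : ℝ) ^ (k + 1) = 2 * 2 ^ (2 * k + 1) := by
      rw [show (4 : ℝ) = 2 ^ 2 by norm_num, ← pow_mul]
      ring
    rw [h, h4]
    push_cast
    field_simp

theorem tendsto_sqrt_mul_choose_middle :
    Tendsto (fun N : ℕ => Real.sqrt (N + 1 : ℕ) * ((N.choose (N / 2) : ℝ) / 2 ^ N)) atTop
      (nhds (Real.sqrt (2 / Real.pi))) := by
  have hk : Tendsto (fun N : ℕ => (N + 1) / 2) atTop atTop :=
    (Nat.tendsto_div_const_atTop two_ne_zero).comp (tendsto_add_atTop_nat 1)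
  have hW := Real.Wallis.tendsto_W_nhds_pi_div_two.comp hk
  have hr : Tendsto (fun N : ℕ => ((N + 1 : ℕ) : ℝ) / (2 * ((N + 1) / 2 : ℕ) + 1)) atTop
      (nhds 1) := by
    have hlo : Tendsto (fun N : ℕ => 1 - 1 / (((N + 1 : ℕ) : ℝ) + 1)) atTop (nhds 1) := by
      simpa using tendsto_const_nhds.sub
        ((tendsto_one_div_add_atTop_nhds_zero_nat (𝕜 := ℝ)).comp (tendsto_add_atTop_nat 1))
    refine tendsto_of_tendsto_of_tendsto_of_le_of_le hlo tendsto_const_nhds ?_ ?_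
    · intro N
      have e : (1 : ℝ) - 1 / (((N + 1 : ℕ) : ℝ) + 1) = (N + 1 : ℕ) / (((N + 1 : ℕ) : ℝ) + 1) := by
        field_simp
        ring
      simp only [e]
      have : (2 : ℝ) * ((N + 1) / 2 : ℕ) ≤ (N + 1 : ℕ) := by
        exact_mod_cast (by lia : 2 * ((N + 1) / 2) ≤ N + 1)
      gcongr
    · intro N
      have : ((N + 1 : ℕ) : ℝ) ≤ 2 * ((N + 1) / 2 : ℕ) + 1 := by
        exact_mod_cast (by lia : N + 1 ≤ 2 * ((N + 1) / 2) + 1)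
      exact (div_le_one (by positivity)).2 this
  have hlim := (hr.div hW (by positivity)).sqrt
  rw [one_div_div] at hlim
  refine hlim.congr fun N => ?_
  set k := (N + 1) / 2 with hkdef
  rw [choose_middle_div_two_pow, ← hkdef]
  have hWp := Real.Wallis.W_pos k
  have h2 := centralBinom_sq_mul_wallis k
  have hpos : (0 : ℝ) ≤ k.centralBinom / 4 ^ k := by positivity
  rw [← Real.sqrt_sq hpos, ← Real.sqrt_mul (by positivity)]
  congr 1
  simp only [Pi.div_apply, Function.comp, ← hkdef]
  rw [div_div, div_eq_iff (by positivity)]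
  linear_combination (-((N + 1 : ℕ) : ℝ)) * h2

theorem tendsto_floor_rpow_div_rpow {α : ℝ} (hα : 0 < α) :
    Tendsto (fun x : ℝ => (⌊x ^ α⌋₊ : ℝ) / x ^ α) atTop (nhds 1) :=
  (tendsto_nat_floor_div_atTop (R := ℝ)).comp (tendsto_rpow_atTop hα)

theorem tendsto_sqrt_mul_V_succ :
    Tendsto (fun N : ℕ => Real.sqrt (N + 1 : ℕ) * V (N + 1)) atTop
      (nhds (Real.sqrt (2 / Real.pi))) := by
  have hx : Tendsto (fun N : ℕ => ((N + 1 : ℕ) : ℝ)) atTop atTop :=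
    tendsto_natCast_atTop_atTop.comp (tendsto_add_atTop_nat 1)
  set m : ℕ → ℕ := fun N => ⌊((N + 1 : ℕ) : ℝ) ^ (0.8 : ℝ)⌋₊ with hm
  set d : ℕ → ℕ := fun N => ⌊((N + 1 : ℕ) : ℝ) ^ (0.45 : ℝ)⌋₊ with hd
  have hmlim := (tendsto_floor_rpow_div_rpow (α := 0.8) (by norm_num)).comp hx
  have hdlim := (tendsto_floor_rpow_div_rpow (α := 0.45) (by norm_num)).comp hx
  have hneg : ∀ β : ℝ, 0 < β → Tendsto (fun N : ℕ => ((N + 1 : ℕ) : ℝ) ^ (-β)) atTop (nhds 0) :=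
    fun β hβ => (tendsto_rpow_neg_atTop hβ).comp hx
  have hF1 : Tendsto (fun N => (m N : ℝ) / (d N : ℝ) ^ 2) atTop (nhds 0) := by
    have h := (hmlim.div (hdlim.pow 2) (by norm_num)).mul (hneg 0.1 (by norm_num))
    rw [mul_zero] at h
    refine h.congr fun N => ?_
    have hp : (0 : ℝ) < (N + 1 : ℕ) := by positivity
    have e : (((N + 1 : ℕ) : ℝ) ^ (0.45 : ℝ)) ^ 2 =
        ((N + 1 : ℕ) : ℝ) ^ (0.8 : ℝ) * ((N + 1 : ℕ) : ℝ) ^ (0.1 : ℝ) := by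
      rw [← Real.rpow_natCast, ← Real.rpow_mul hp.le, ← Real.rpow_add hp]
      norm_num
    simp only [Pi.div_apply, Function.comp, hm, hd, div_pow, e, Real.rpow_neg hp.le]
    field_simp
  have hF2 : Tendsto (fun N => ((N + 1 : ℕ) : ℝ) / (m N * (2 * d N : ℕ))) atTop (nhds 0) := by
    have h := ((hneg 0.25 (by norm_num)).div (hmlim.mul (hdlim.const_mul 2)) (by norm_num))
    rw [zero_div] at h
    refine h.congr fun N => ?_
    have hp : (0 : ℝ) < (N + 1 : ℕ) := by positivity
    have e : ((N + 1 : ℕ) : ℝ) ^ (0.8 : ℝ) * ((N + 1 : ℕ) : ℝ) ^ (0.45 : ℝ) =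
        ((N + 1 : ℕ) : ℝ) * ((N + 1 : ℕ) : ℝ) ^ (0.25 : ℝ) := by
      rw [← Real.rpow_add hp, ← Real.rpow_one_add' hp.le (by norm_num)]
      norm_num
    simp only [Pi.div_apply, Function.comp, hm, hd, Real.rpow_neg hp.le]
    rw [Nat.cast_mul, Nat.cast_ofNat, inv_eq_one_div, mul_div_assoc', div_mul_div_comm, e]
    field_simp
  have hR : Tendsto (fun N => ((2 * d N : ℕ) : ℝ) ^ 2 / ((N / 2 : ℕ) + 1)) atTop (nhds 0) := by
    have h := (((hdlim.pow 2).const_mul 8)).mul (hneg 0.1 (by norm_num))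
    rw [mul_zero] at h
    refine tendsto_of_tendsto_of_tendsto_of_le_of_le tendsto_const_nhds h
      (fun N => by positivity) fun N => ?_
    have hp : (0 : ℝ) < (N + 1 : ℕ) := by positivity
    have e : (((N + 1 : ℕ) : ℝ) ^ (0.45 : ℝ)) ^ 2 * ((N + 1 : ℕ) : ℝ) ^ (0.1 : ℝ) =
        (N + 1 : ℕ) := by
      rw [← Real.rpow_natCast, ← Real.rpow_mul hp.le, ← Real.rpow_add hp]
      norm_num
    have e2 : 8 * ((d N : ℝ) / ((N + 1 : ℕ) : ℝ) ^ (0.45 : ℝ)) ^ 2 *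
        ((N + 1 : ℕ) : ℝ) ^ (-(0.1 : ℝ)) = ((2 * d N : ℕ) : ℝ) ^ 2 / ((N + 1 : ℕ) / 2) := by
      conv_rhs => rw [← e]
      rw [Real.rpow_neg hp.le]
      push_cast
      field_simp
      ring
    change _ ≤ 8 * ((d N : ℝ) / ((N + 1 : ℕ) : ℝ) ^ (0.45 : ℝ)) ^ 2 *
        ((N + 1 : ℕ) : ℝ) ^ (-(0.1 : ℝ))
    rw [e2]
    gcongr
    rw [div_le_iff₀ two_pos]
    exact_mod_cast (by lia : N + 1 ≤ (N / 2 + 1) * 2)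
  have hmsmall : Tendsto (fun N => (m N : ℝ) / (N + 1 : ℕ)) atTop (nhds 0) := by
    have h := hmlim.mul (hneg 0.2 (by norm_num))
    rw [mul_zero] at h
    refine h.congr fun N => ?_
    have hp : (0 : ℝ) < (N + 1 : ℕ) := by positivity
    have e : ((N + 1 : ℕ) : ℝ) ^ (0.8 : ℝ) * ((N + 1 : ℕ) : ℝ) ^ (0.2 : ℝ) = (N + 1 : ℕ) := by
      rw [← Real.rpow_add hp]
      norm_num
    conv_rhs => rw [← e]
    simp only [Function.comp, hm, Real.rpow_neg hp.le]
    field_simp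
  have hM := tendsto_sqrt_mul_choose_middle
  have hlow := (((hF1.const_mul 100).add hF2).const_sub 1).mul ((hR.const_sub 1).mul hM)
  simp only [mul_zero, add_zero, sub_zero, one_mul] at hlow
  refine tendsto_of_tendsto_of_tendsto_of_le_of_le' hlow hM ?_ ?_
  · filter_upwards [hR.eventually_le_const zero_lt_one,
      hmsmall.eventually_le_const (by norm_num : (0 : ℝ) < 1 / 2)] with N hRN hmN
    have hx1 : (1 : ℝ) ≤ (N + 1 : ℕ) := by exact_mod_cast Nat.succ_pos N
    have hd0 : 0 < d N := Nat.floor_pos.2 (Real.one_le_rpow hx1 (by norm_num))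
    have hm0 : 0 < m N := Nat.floor_pos.2 (Real.one_le_rpow hx1 (by norm_num))
    have hm2 : 2 * m N ≤ N + 1 := by
      rw [div_le_div_iff₀ (by positivity) two_pos] at hmN
      have : m N * 2 ≤ 1 * (N + 1) := by exact_mod_cast hmN
      lia
    have hd2 : 2 * d N ≤ N / 2 := by
      rw [div_le_one (by positivity)] at hRN
      have : (2 * d N) ^ 2 ≤ N / 2 + 1 := by exact_mod_cast hRN
      nlinarith
    have key := mul_le_mul_of_nonneg_left (le_V hd0 hm0 hm2 hd2 hRN)
      (Real.sqrt_nonneg (N + 1 : ℕ))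
    refine le_trans (le_of_eq ?_) key
    ring
  · exact Eventually.of_forall fun N => mul_le_mul_of_nonneg_left (V_le N) (Real.sqrt_nonneg _)

/-- The optimal stopping algorithm has asymptotic success probability
`(1/√n) · √(2/π)`: namely `√n · V(n) → √(2/π)`. -/
theorem optimal_value_asymptotic :
    Tendsto (fun n : ℕ => Real.sqrt n * V n) atTop (nhds (Real.sqrt (2 / Real.pi))) := by
  exact (tendsto_add_atTop_iff_nat 1).1 tendsto_sqrt_mul_V_succ
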